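/- Let X = {x₁, …, x_l} and Y = {−y₁, …, −y_m} be disjoint nonempty sets of even integers, where x₁ > ⋯ > x_l are non-negative even integers and y₁ < ⋯ < y_m are positive even integers, with X ∪ Y ≠ {0}. If there exist an odd number of (not necessarily distinct) elements −y_{p₁}, …, −y_{p_{2r+1}} ∈ Y and an even number of (not necessarily distinct) elements x_{q₁}, …, x_{q_{2s}} ∈ X such that y_{p₁} + ⋯ + y_{p_{2r+1}} = x_{q₁} + ⋯ + x_{q_{2s}}, then X ∪ Y is the imbalance set of some tournament. -/

import Mathlib

/-- A tournament on `Fin n`: loopless, and between any two distinct vertices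
there is exactly one arc. -/
def IsTournament {n : ℕ} (r : Fin n → Fin n → Bool) : Prop :=
  (∀ i, r i i = false) ∧ ∀ i j : Fin n, i ≠ j → (r i j = !(r j i))

/-- The score (outdegree) of vertex `i`. -/
def outdeg {n : ℕ} (r : Fin n → Fin n → Bool) (i : Fin n) : ℕ :=
  (Finset.univ.filter fun j => r i j = true).card

/-- The indegree of vertex `i`. -/
def indeg {n : ℕ} (r : Fin n → Fin n → Bool) (i : Fin n) : ℕ :=
  (Finset.univ.filter fun j => r j i = true).card

/-- The imbalance of vertex `i`: outdegree minus indegree. -/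
def imbalance {n : ℕ} (r : Fin n → Fin n → Bool) (i : Fin n) : ℤ :=
  (outdeg r i : ℤ) - (indeg r i : ℤ)

/-- The imbalance set of a digraph. -/
def imbalanceSet {n : ℕ} (r : Fin n → Fin n → Bool) : Finset ℤ :=
  Finset.image (imbalance r) Finset.univ

/-- The contribution of the pair `(i, j)` to the imbalance of `i`. -/
def arcSign {n : ℕ} (T : Fin n → Fin n → Bool) (i j : Fin n) : ℤ :=
  (if T i j = true then 1 else 0) - (if T j i = true then 1 else 0)

lemma imbalance_eq_sum {n : ℕ} (T : Fin n → Fin n → Bool) (i : Fin n) :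
    imbalance T i = ∑ j, arcSign T i j := by
  simp [imbalance, outdeg, indeg, arcSign, Finset.sum_sub_distrib]

lemma arcSign_antisymm {n : ℕ} (T : Fin n → Fin n → Bool) (i j : Fin n) :
    arcSign T i j = - arcSign T j i := by
  simp [arcSign]

lemma sum_arcSign_self {n : ℕ} (T : Fin n → Fin n → Bool) (A : Finset (Fin n)) :
    ∑ i ∈ A, ∑ j ∈ A, arcSign T i j = 0 := by
  have h1 : ∑ i ∈ A, ∑ j ∈ A, arcSign T i j = ∑ i ∈ A, ∑ j ∈ A, arcSign T j i :=
    Finset.sum_comm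
  have h2 : ∑ i ∈ A, ∑ j ∈ A, arcSign T i j = - ∑ i ∈ A, ∑ j ∈ A, arcSign T j i := by
    simp only [← Finset.sum_neg_distrib]
    exact Finset.sum_congr rfl fun i _ => Finset.sum_congr rfl fun j _ => arcSign_antisymm T i j
  linarith

lemma sum_imbalance {n : ℕ} (T : Fin n → Fin n → Bool) : ∑ i, imbalance T i = 0 := by
  simp only [imbalance_eq_sum]
  exact sum_arcSign_self T Finset.univ

lemma sum_imbalance_closed {n : ℕ} (T : Fin n → Fin n → Bool) (hT : IsTournament T)
    (A : Finset (Fin n)) (hA : ∀ v ∈ A, ∀ w, w ∉ A → T v w = false) :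
    ∑ i ∈ A, imbalance T i = - ((A.card : ℤ) * ((n : ℤ) - A.card)) := by
  simp only [imbalance_eq_sum]
  have h1 : ∀ i ∈ A, ∑ j, arcSign T i j = ∑ j ∈ A, arcSign T i j - ((n : ℤ) - A.card) := by
    intro i hi
    rw [← Finset.sum_add_sum_compl A]
    have h2 : ∑ j ∈ Aᶜ, arcSign T i j = ∑ j ∈ Aᶜ, (-1 : ℤ) := by
      refine Finset.sum_congr rfl fun j hj => ?_
      have hj' : j ∉ A := by simpa using hj
      have h3 := hA i hi j hj'
      have hne : i ≠ j := fun h => hj' (h ▸ hi)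
      have h4 := hT.2 i j hne
      rw [h3] at h4
      have h5 : T j i = true := by simpa using h4
      simp [arcSign, h3, h5]
    rw [h2, Finset.sum_const, Finset.card_compl, Fintype.card_fin]
    have : A.card ≤ n := by simpa using Finset.card_le_univ A
    simp [Nat.cast_sub this]
    ring
  rw [Finset.sum_congr rfl h1, Finset.sum_sub_distrib, sum_arcSign_self]
  simp
  ring

lemma exists_flip {n : ℕ} (T : Fin n → Fin n → Bool) (hT : IsTournament T) (v w : Fin n)
    (hvw : T v w = true) :
    ∃ T' : Fin n → Fin n → Bool, IsTournament T' ∧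
      (∀ i j, ¬ (i = v ∧ j = w) → ¬ (i = w ∧ j = v) → T' i j = T i j) ∧
      ∀ i, imbalance T' i =
        imbalance T i - (if i = v then 2 else 0) + (if i = w then 2 else 0) := by
  have hne : v ≠ w := by
    rintro rfl
    simp [hT.1] at hvw
  have hwv : T w v = false := by
    have := hT.2 w v hne.symm
    simpa [hvw] using this
  refine ⟨fun i j => if i = v ∧ j = w then false else if i = w ∧ j = v then true else T i j,
    ⟨?_, ?_⟩, ?_, ?_⟩
  · intro i
    have := hT.1 i
    grind
  · intro i j hij
    have := hT.2 i j hij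
    grind
  · intro i j h1 h2
    simp [h1, h2]
  · intro i
    rw [imbalance_eq_sum, imbalance_eq_sum]
    have key : ∀ j, arcSign (fun i j => if i = v ∧ j = w then false else
        if i = w ∧ j = v then true else T i j) i j
        = arcSign T i j - (if j = w then (if i = v then 2 else 0) else 0)
          + (if j = v then (if i = w then 2 else 0) else 0) := by
      intro j
      simp only [arcSign]
      grind
    rw [Finset.sum_congr rfl fun j _ => key j]
    simp [Finset.sum_add_distrib, Finset.sum_sub_distrib]

lemma even_imbalance {n : ℕ} (hn : Odd n) (T : Fin n → Fin n → Bool) (hT : IsTournament T)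
    (i : Fin n) : Even (imbalance T i) := by
  have h : (outdeg T i) + (indeg T i) + 1 = n := by
    have h1 : ∑ j : Fin n, ((if T i j = true then 1 else 0) + (if T j i = true then 1 else 0)
        + (if j = i then 1 else 0)) = ∑ j : Fin n, 1 := by
      refine Finset.sum_congr rfl fun j _ => ?_
      by_cases hij : j = i
      · subst hij
        simp [hT.1]
      · have := hT.2 j i hij
        cases h : T i j <;> simp [h, hij, this]
    simpa [Finset.sum_add_distrib, outdeg, indeg] using h1
  obtain ⟨k, hk⟩ := hn
  unfold imbalance
  rw [Int.even_iff]
  omega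

/-- The set of vertices to which imbalance can be shipped from `u`. -/
lemma exists_closed {n : ℕ} (T : Fin n → Fin n → Bool) (hT : IsTournament T) (u : Fin n) :
    ∃ A : Finset (Fin n), u ∈ A ∧ (∀ v ∈ A, ∀ w, w ∉ A → T v w = false) ∧
      ∀ w ∈ A, ∃ T' : Fin n → Fin n → Bool, IsTournament T' ∧
        ∀ i, imbalance T' i =
          imbalance T i - (if i = u then 2 else 0) + (if i = w then 2 else 0) := by
  classical
  let P : Finset (Fin n) → Prop := fun A => u ∈ A ∧ ∀ w ∈ A, ∃ T' : Fin n → Fin n → Bool,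
    IsTournament T' ∧ (∀ i j, ¬ (i ∈ A ∧ j ∈ A) → T' i j = T i j) ∧
    ∀ i, imbalance T' i = imbalance T i - (if i = u then 2 else 0) + (if i = w then 2 else 0)
  have hP : P {u} := by
    refine ⟨by simp, fun w hw => ⟨T, hT, fun _ _ _ => rfl, fun i => ?_⟩⟩
    rw [Finset.mem_singleton.1 hw]
    ring
  obtain ⟨A, hA, hmax⟩ := Finset.exists_max_image (Finset.univ.filter P) Finset.card
    ⟨{u}, by simpa using hP⟩
  have hPA : P A := by simpa using hA
  refine ⟨A, hPA.1, ?_, ?_⟩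
  · intro v hv w hw
    by_contra hvw
    have hvw' : T v w = true := by simpa using hvw
    obtain ⟨T1, hT1, hd1, hi1⟩ := hPA.2 v hv
    have h1 : T1 v w = true := by
      rw [hd1 v w (fun h => hw h.2), hvw']
    obtain ⟨T2, hT2, hd2, hi2⟩ := exists_flip T1 hT1 v w h1
    have hPA' : P (insert w A) := by
      refine ⟨Finset.mem_insert_of_mem hPA.1, fun x hx => ?_⟩
      rcases Finset.mem_insert.1 hx with rfl | hx
      · refine ⟨T2, hT2, fun i j hij => ?_, fun i => ?_⟩
        · rw [hd2, hd1]
          · grind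
          · grind
          · grind
        · rw [hi2, hi1]
          ring
      · obtain ⟨T3, hT3, hd3, hi3⟩ := hPA.2 x hx
        refine ⟨T3, hT3, fun i j hij => hd3 i j ?_, hi3⟩
        grind
    have := hmax (insert w A) (by simpa using hPA')
    rw [Finset.card_insert_of_notMem hw] at this
    omega
  · intro w hw
    obtain ⟨T', h1, _, h3⟩ := hPA.2 w hw
    exact ⟨T', h1, h3⟩

/-- Landau's theorem for even imbalance sequences. -/
lemma landau {n : ℕ} (hn : Odd n) (t : Fin n → ℤ) (hev : ∀ i, Even (t i))
    (hsum : ∑ i, t i = 0)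
    (hL : ∀ A : Finset (Fin n), - ((A.card : ℤ) * ((n : ℤ) - A.card)) ≤ ∑ i ∈ A, t i) :
    ∃ T : Fin n → Fin n → Bool, IsTournament T ∧ ∀ i, imbalance T i = t i := by
  classical
  have main : ∀ (m : ℕ) (T : Fin n → Fin n → Bool), IsTournament T →
      ∑ i, (imbalance T i - t i).natAbs = m →
      ∃ T : Fin n → Fin n → Bool, IsTournament T ∧ ∀ i, imbalance T i = t i := by
    intro m
    induction m using Nat.strong_induction_on with
    | _ m ih =>
      intro T hT hm
      by_cases hall : ∀ i, imbalance T i = t i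
      · exact ⟨T, hT, hall⟩
      · have hu : ∃ u, t u < imbalance T u := by
          by_contra! hcon
          refine hall fun i => ?_
          have := (Finset.sum_eq_sum_iff_of_le (s := Finset.univ) (fun i _ => hcon i)).1
            (by rw [sum_imbalance, hsum])
          exact this i (Finset.mem_univ i)
        obtain ⟨u, hu⟩ := hu
        obtain ⟨A, huA, hcl, hA⟩ := exists_closed T hT u
        have h1 := hL A
        rw [← sum_imbalance_closed T hT A hcl] at h1
        have hw : ∃ w ∈ A, imbalance T w < t w := by
          by_contra! hcon
          exact absurd h1 (not_le.2 (Finset.sum_lt_sum hcon ⟨u, huA, hu⟩))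
        obtain ⟨w, hwA, hw⟩ := hw
        obtain ⟨T', hT', hi⟩ := hA w hwA
        refine ih _ ?_ T' hT' rfl
        rw [← hm]
        refine Finset.sum_lt_sum (fun i _ => ?_) ⟨u, Finset.mem_univ u, ?_⟩
        · have e1 := even_imbalance hn T hT i
          have e2 := hev i
          rw [Int.even_iff] at e1 e2
          rw [hi]
          split_ifs with h2 h3 h3
          · omega
          · subst h2
            omega
          · subst h3
            omega
          · omega
        · have e1 := even_imbalance hn T hT u
          have e2 := hev u
          rw [Int.even_iff] at e1 e2
          have hne : u ≠ w := by
            rintro rfl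
            omega
          rw [hi, if_pos rfl, if_neg hne]
          omega
  refine main _ (fun i j => decide (i < j)) ⟨by simp, fun i j hij => ?_⟩ rfl
  rcases lt_or_gt_of_ne hij with h | h <;> simp [h, h.le]

lemma realize_bounded {n : ℕ} (hn : Odd n) (t : Fin n → ℤ) (hev : ∀ i, Even (t i))
    (hsum : ∑ i, t i = 0) (B : ℤ) (hB : ∀ i, |t i| ≤ B) (hnB : 2 * B ≤ n) :
    ∃ T : Fin n → Fin n → Bool, IsTournament T ∧ ∀ i, imbalance T i = t i := by
  classical
  refine landau hn t hev hsum fun A => ?_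
  have hc : (A.card : ℤ) ≤ n := by exact_mod_cast (by simpa using Finset.card_le_univ A)
  have hc' : ((Aᶜ).card : ℤ) = n - A.card := by
    rw [Finset.card_compl, Fintype.card_fin, Nat.cast_sub (by exact_mod_cast hc)]
  have h0 : (0 : ℤ) ≤ A.card := by positivity
  rcases le_total (2 * (A.card : ℤ)) n with h | h
  · have h1 : ∑ i ∈ A, (-B) ≤ ∑ i ∈ A, t i :=
      Finset.sum_le_sum fun i _ => (abs_le.1 (hB i)).1
    rw [Finset.sum_const, nsmul_eq_mul] at h1
    have h2 : B ≤ n - A.card := by linarith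
    have := mul_le_mul_of_nonneg_left h2 h0
    linarith
  · have h1 : ∑ i ∈ Aᶜ, t i ≤ ∑ i ∈ Aᶜ, B :=
      Finset.sum_le_sum fun i _ => (abs_le.1 (hB i)).2
    rw [Finset.sum_const, nsmul_eq_mul, hc'] at h1
    have h3 := Finset.sum_add_sum_compl A t
    rw [hsum] at h3
    have h2 : B ≤ A.card := by linarith
    have := mul_le_mul_of_nonneg_left h2 (by linarith : (0 : ℤ) ≤ n - A.card)
    linarith

lemma realize_list (L : List ℤ) (hodd : Odd L.length) (hev : ∀ x ∈ L, Even x)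
    (hsum : L.sum = 0) :
    ∃ (n : ℕ) (T : Fin n → Fin n → Bool), IsTournament T ∧ imbalanceSet T = L.toFinset := by
  obtain ⟨B, hB⟩ : ∃ B : ℕ, ∀ x ∈ L, |x| ≤ (B : ℤ) := by
    refine ⟨(L.map Int.natAbs).sum, fun x hx => ?_⟩
    have := List.single_le_sum (l := L.map Int.natAbs) (by simp) x.natAbs
      (List.mem_map_of_mem hx)
    rw [Int.abs_eq_natAbs]
    exact_mod_cast this
  obtain ⟨M, hM⟩ : ∃ M, M = (List.replicate (2 * B + 1) L).flatten := ⟨_, rfl⟩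
  have hmem : ∀ x, x ∈ M ↔ x ∈ L := by
    intro x
    simp [hM, List.mem_flatten, List.mem_replicate]
  have hlen : M.length = (2 * B + 1) * L.length := by simp [hM]
  have hMs : M.sum = 0 := by simp [hM, List.sum_flatten, hsum]
  have hMo : Odd M.length := by
    rw [hlen]
    exact Odd.mul (by simp) hodd
  obtain ⟨T, hT, hi⟩ := realize_bounded hMo M.get
    (fun i => hev _ ((hmem _).1 (List.get_mem _ _)))
    (by rw [← hMs, ← List.sum_ofFn, List.ofFn_get]) B
    (fun i => hB _ ((hmem _).1 (List.get_mem _ _)))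
    (by
      have := hodd.pos
      have h2 : 2 * B ≤ M.length := by
        rw [hlen]
        nlinarith
      exact_mod_cast h2)
  refine ⟨_, T, hT, ?_⟩
  ext x
  simp only [imbalanceSet, Finset.mem_image, Finset.mem_univ, true_and, List.mem_toFinset, hi]
  rw [← hmem, List.mem_iff_get]

/-- An even-length zero-sum list with entries in `X ∪ Y`. -/
lemma exists_filler (X Y : Finset ℤ) (hX : ∀ x ∈ X, 0 ≤ x ∧ Even x)
    (hY : ∀ y ∈ Y, y < 0 ∧ Even y) (S : Finset (ℤ × ℤ)) (hS : S ⊆ X ×ˢ Y) :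
    ∃ L : List ℤ, Even L.length ∧ L.sum = 0 ∧ (∀ z ∈ L, z ∈ X ∪ Y) ∧
      ∀ p ∈ S, p.1 ∈ L ∧ (p.1 ≠ 0 → p.2 ∈ L) := by
  classical
  induction S using Finset.induction_on with
  | empty => exact ⟨[], by simp⟩
  | insert p S hp ih =>
    obtain ⟨L, h1, h2, h3, h4⟩ := ih fun q hq => hS (Finset.mem_insert_of_mem hq)
    obtain ⟨hx, hy⟩ := Finset.mem_product.1 (hS (Finset.mem_insert_self p S))
    obtain ⟨x, y⟩ := p
    simp only at hx hy
    obtain ⟨hx0, hxe⟩ := hX x hx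
    obtain ⟨hy0, hye⟩ := hY y hy
    obtain ⟨c, rfl⟩ := Int.eq_ofNat_of_zero_le hx0
    obtain ⟨d, hd⟩ := Int.eq_ofNat_of_zero_le (by linarith : 0 ≤ -y)
    have hdy : y = -(d : ℤ) := by linarith
    subst hdy
    have hc : Even c := by exact_mod_cast hxe
    have hd' : Even d := by
      rw [even_neg] at hye
      exact_mod_cast hye
    have hdpos : d ≠ 0 := by
      rintro rfl
      simp at hy0
    refine ⟨List.replicate d (c : ℤ) ++ List.replicate c (-(d : ℤ)) ++ L, ?_, ?_, ?_, ?_⟩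
    · simp only [List.length_append, List.length_replicate]
      exact (hd'.add hc).add h1
    · simp [h2]
      ring
    · intro z hz
      simp only [List.mem_append, List.mem_replicate] at hz
      rcases hz with (⟨_, rfl⟩ | ⟨_, rfl⟩) | hz
      · exact Finset.mem_union_left _ hx
      · exact Finset.mem_union_right _ hy
      · exact h3 z hz
    · intro q hq
      rcases Finset.mem_insert.1 hq with rfl | hq
      · simp only [List.mem_append, List.mem_replicate]
        refine ⟨Or.inl (Or.inl ⟨hdpos, trivial⟩), fun h => Or.inl (Or.inr ⟨?_, trivial⟩)⟩
        exact_mod_cast h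
      · obtain ⟨h5, h6⟩ := h4 q hq
        exact ⟨List.mem_append_right _ h5, fun h => List.mem_append_right _ (h6 h)⟩

/-- If an odd number of elements of `−Y` and an even number of
elements of `X` have equal sums, then `X ∪ Y` is a tournament imbalance set. -/
theorem even_imbalanceSet_of_odd_even_sums' (X Y : Finset ℤ)
    (hXne : X.Nonempty) (hYne : Y.Nonempty) (hdisj : Disjoint X Y)
    (hX : ∀ x ∈ X, 0 ≤ x ∧ Even x) (hY : ∀ y ∈ Y, y < 0 ∧ Even y)
    (hXY : X ∪ Y ≠ {0})
    (h : ∃ (r s : ℕ) (a : Fin (2 * r + 1) → ℤ) (b : Fin (2 * s) → ℤ),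
      (∀ i, -(a i) ∈ Y) ∧ (∀ i, b i ∈ X) ∧ ∑ i, a i = ∑ i, b i) :
    ∃ (n : ℕ) (T : Fin n → Fin n → Bool),
      IsTournament T ∧ imbalanceSet T = X ∪ Y := by
  classical
  obtain ⟨r, s, a, b, ha, hb, hab⟩ := h
  obtain ⟨L, h1, h2, h3, h4⟩ := exists_filler X Y hX hY (X ×ˢ Y) subset_rfl
  -- some element of X is nonzero
  have hx : ∃ x ∈ X, x ≠ 0 := by
    by_contra! hcon
    have hb0 : ∑ i, b i = 0 := Finset.sum_eq_zero fun i _ => hcon _ (hb i)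
    have ha0 : 0 < ∑ i, a i :=
      Finset.sum_pos (fun i _ => by linarith [(hY _ (ha i)).1]) ⟨0, Finset.mem_univ _⟩
    linarith
  obtain ⟨x0, hx0, hx0'⟩ := hx
  obtain ⟨y0, hy0⟩ := hYne
  let M : List ℤ := List.ofFn (fun i => -(a i)) ++ List.ofFn b ++ L
  have hMmem : ∀ z ∈ M, z ∈ X ∪ Y := by
    intro z hz
    simp only [M, List.mem_append, List.mem_ofFn] at hz
    rcases hz with (⟨i, rfl⟩ | ⟨i, rfl⟩) | hz
    · exact Finset.mem_union_right _ (ha i)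
    · exact Finset.mem_union_left _ (hb i)
    · exact h3 z hz
  obtain ⟨n, T, hT, hi⟩ := realize_list M
    (by
      simp only [M, List.length_append, List.length_ofFn]
      refine Odd.add_even (Odd.add_even (by simp) (by simp)) h1)
    (fun z hz => by
      rcases Finset.mem_union.1 (hMmem z hz) with h | h
      · exact (hX z h).2
      · exact (hY z h).2)
    (by
      simp only [M, List.sum_append, List.sum_ofFn, Finset.sum_neg_distrib]
      linarith)
  refine ⟨n, T, hT, ?_⟩
  rw [hi]
  ext z
  rw [List.mem_toFinset]
  refine ⟨hMmem z, fun hz => List.mem_append_right _ ?_⟩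
  rcases Finset.mem_union.1 hz with h | h
  · exact (h4 (z, y0) (Finset.mk_mem_product h hy0)).1
  · exact (h4 (x0, z) (Finset.mk_mem_product hx0 h)).2 hx0'
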